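/- Let m, n ≥ 1, for i,j ∈ {1,…,m} let C_{ij} ∈ ℂ^{n×n} be the circulant matrix with first column c^{(ij)} ∈ ℂ^n, and let C_B = [C_{ij}]_{i,j=1}^m ∈ ℂ^{mn×mn}. For k ∈ {0,…,n−1} define D_k ∈ ℂ^{m×m} by (D_k)_{ij} = (F_n c^{(ij)})_k. Then C_B is invertible if and only if every D_k is invertible, and in that case the (i,j) block of C_B^{−1} equals F_n^{−1} · diag((D_0^{−1})_{ij},…,(D_{n−1}^{−1})_{ij}) · F_n; in particular every block of C_B^{−1} is circulant. -/

import Mathlib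

open Matrix BigOperators

open scoped Kronecker

/-- A matrix whose rows are additive characters diagonalizes every circulant matrix. -/
theorem mul_circulant_of_map_add {ι G R : Type*} [Fintype ι] [DecidableEq ι] [Fintype G]
    [AddGroup G] [CommSemiring R] {F : Matrix ι G R}
    (hF : ∀ k p q, F k (p + q) = F k p * F k q) (v : G → R) :
    F * circulant v = diagonal (F *ᵥ v) * F := by
  ext k q
  rw [diagonal_mul, mul_apply, mulVec, dotProduct, Finset.sum_mul,
    ← Equiv.sum_comp (Equiv.addRight q)]
  refine Finset.sum_congr rfl fun r _ => ?_
  simp only [Equiv.coe_addRight, circulant_apply, add_sub_cancel_right, hF]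
  ring

/-- An invertible matrix whose rows are additive characters conjugates every diagonal matrix to
a circulant one. -/
theorem inv_mul_diagonal_mul_eq_circulant {G R : Type*} [Fintype G] [DecidableEq G]
    [AddGroup G] [CommRing R] {F : Matrix G G R} (hdet : IsUnit F.det)
    (hF : ∀ k p q, F k (p + q) = F k p * F k q) (d : G → R) :
    F⁻¹ * diagonal d * F = circulant (F⁻¹ *ᵥ d) := by
  have h := mul_circulant_of_map_add hF (F⁻¹ *ᵥ d)
  rw [mulVec_mulVec, mul_nonsing_inv _ hdet, one_mulVec] at h
  rw [Matrix.mul_assoc, ← h, nonsing_inv_mul_cancel_left _ _ hdet]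

/-- The blocks of a block diagonal matrix conjugated by a Kronecker product with the identity. -/
theorem one_kronecker_mul_blockDiagonal_mul_apply {m n R : Type*} [Fintype m] [DecidableEq m]
    [Fintype n] [DecidableEq n] [CommSemiring R] (A B : Matrix n n R) (D : n → Matrix m m R)
    (i j : m) (p q : n) :
    (((1 : Matrix m m R) ⊗ₖ A) * blockDiagonal D * ((1 : Matrix m m R) ⊗ₖ B)) (i, p) (j, q) =
      (A * diagonal (fun k => D k i j) * B) p q := by
  simp [mul_apply, Fintype.sum_prod_type, blockDiagonal_apply, one_apply, diagonal_apply]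

/-- The inverse of a block diagonal matrix with invertible blocks. -/
theorem blockDiagonal_mul_blockDiagonal_inv {m n R : Type*} [Fintype m] [DecidableEq m]
    [Fintype n] [DecidableEq n] [CommRing R] {D : n → Matrix m m R} (hD : ∀ k, IsUnit (D k)) :
    blockDiagonal D * blockDiagonal (fun k => (D k)⁻¹) = 1 := by
  rw [← blockDiagonal_mul, ← blockDiagonal_one]
  congr 1
  ext1 k
  exact mul_nonsing_inv _ ((isUnit_iff_isUnit_det _).1 (hD k))

/-- A block diagonal matrix is invertible if and only if all its blocks are. -/
theorem isUnit_blockDiagonal_iff {m n R : Type*} [Fintype m] [DecidableEq m]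
    [Fintype n] [DecidableEq n] [CommRing R] {D : n → Matrix m m R} :
    IsUnit (blockDiagonal D) ↔ ∀ k, IsUnit (D k) := by
  simp [isUnit_iff_isUnit_det, det_blockDiagonal]

/-- Inversion of a matrix with circulant blocks: let `C_B` have `(i,j)` block the
circulant matrix with first column `c^{(ij)}`, and for each `k` let
`(D_k)_{ij} = (F_n c^{(ij)})_k` where `F_n` is the discrete Fourier matrix.
Then `C_B` is invertible iff every `D_k` is invertible, and in that case the `(i,j)`
block of `C_B⁻¹` is `F⁻¹ · diag((D_k⁻¹)_{ij})_k · F`; in particular every block of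
`C_B⁻¹` is circulant. -/
theorem block_circulant_inverse
    (m n : ℕ) (hm : 1 ≤ m) (hn : 1 ≤ n)
    (c : Fin m → Fin m → Fin n → ℂ)
    (CB : Matrix (Fin m × Fin n) (Fin m × Fin n) ℂ)
    (hCB : ∀ (i j : Fin m) (p q : Fin n), CB (i, p) (j, q) = Matrix.circulant (c i j) p q)
    (F : Matrix (Fin n) (Fin n) ℂ)
    (hF : ∀ j k : Fin n,
      F j k = Complex.exp (-(2 * (Real.pi : ℂ) * Complex.I * ((j : ℕ) : ℂ) * ((k : ℕ) : ℂ)) / (n : ℂ)))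
    (D : Fin n → Matrix (Fin m) (Fin m) ℂ)
    (hD : ∀ (k : Fin n) (i j : Fin m), D k i j = F.mulVec (c i j) k) :
    (IsUnit CB ↔ ∀ k : Fin n, IsUnit (D k)) ∧
    ((∀ k : Fin n, IsUnit (D k)) → ∀ i j : Fin m,
      (Matrix.of (fun p q : Fin n => CB⁻¹ (i, p) (j, q)) =
        F⁻¹ * Matrix.diagonal (fun k => (D k)⁻¹ i j) * F) ∧
      ∃ b : Fin n → ℂ,
        Matrix.of (fun p q : Fin n => CB⁻¹ (i, p) (j, q)) = Matrix.circulant b) := by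
  have : NeZero n := ⟨by omega⟩
  have hω := (Complex.isPrimitiveRoot_exp n (NeZero.ne n)).inv
  set ω := (Complex.exp (2 * Real.pi * Complex.I / n))⁻¹ with hωdef
  have hFω (j k : Fin n) : F j k = (ω ^ (j : ℕ)) ^ (k : ℕ) := by
    rw [hF, hωdef, ← Complex.exp_neg, ← Complex.exp_nat_mul, ← Complex.exp_nat_mul]
    congr 1
    ring
  have hdet : IsUnit F.det := by
    have hFV : F = vandermonde fun j : Fin n => ω ^ (j : ℕ) := by
      ext j k
      rw [hFω, vandermonde_apply]
    rw [hFV, isUnit_iff_ne_zero, det_vandermonde_ne_zero_iff]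
    exact fun a b hab => Fin.ext (hω.pow_inj a.2 b.2 hab)
  have hadd (k p q : Fin n) : F k (p + q) = F k p * F k q := by
    have hk : (ω ^ (k : ℕ)) ^ n = 1 := by rw [pow_right_comm, hω.pow_eq_one, one_pow]
    rw [hFω, hFω, hFω, Fin.val_add, ← pow_add, ← pow_eq_pow_mod _ hk]
  have hFF : F * F⁻¹ = 1 := mul_nonsing_inv _ hdet
  have hFF' : F⁻¹ * F = 1 := nonsing_inv_mul _ hdet
  set K := (1 : Matrix (Fin m) (Fin m) ℂ) ⊗ₖ F
  set L := (1 : Matrix (Fin m) (Fin m) ℂ) ⊗ₖ F⁻¹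
  have hKL : K * L = 1 := by rw [← mul_kronecker_mul, hFF, one_mul, one_kronecker_one]
  have hLK : L * K = 1 := mul_eq_one_comm.1 hKL
  have hCB' : CB = L * blockDiagonal D * K := by
    ext ⟨i, p⟩ ⟨j, q⟩
    have hdiag : (fun k => D k i j) = F *ᵥ c i j := funext fun k => hD k i j
    rw [one_kronecker_mul_blockDiagonal_mul_apply, hCB, hdiag, Matrix.mul_assoc,
      ← mul_circulant_of_map_add hadd, nonsing_inv_mul_cancel_left _ _ hdet]
  have hK : IsUnit K := .of_mul_eq_one _ hKL
  have hL : IsUnit L := .of_mul_eq_one _ hLK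
  refine ⟨?_, fun hDu i j => ?_⟩
  · rw [hCB', hK.mul_right_iff, hL.mul_left_iff, isUnit_blockDiagonal_iff]
  have hinv : CB⁻¹ = L * blockDiagonal (fun k => (D k)⁻¹) * K := by
    refine inv_eq_right_inv ?_
    calc CB * (L * blockDiagonal (fun k => (D k)⁻¹) * K)
        = L * (blockDiagonal D * (K * L) * blockDiagonal (fun k => (D k)⁻¹)) * K := by
          rw [hCB']
          simp only [Matrix.mul_assoc]
      _ = 1 := by
          rw [hKL, Matrix.mul_one, blockDiagonal_mul_blockDiagonal_inv hDu, Matrix.mul_one, hLK]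
  have hblock : Matrix.of (fun p q : Fin n => CB⁻¹ (i, p) (j, q)) =
      F⁻¹ * diagonal (fun k => (D k)⁻¹ i j) * F := by
    ext p q
    rw [of_apply, hinv, one_kronecker_mul_blockDiagonal_mul_apply]
  exact ⟨hblock, _, hblock.trans (inv_mul_diagonal_mul_eq_circulant hdet hadd _)⟩
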